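/- arXiv:1110.5585 — 3 statements merged into one kernel-verified Lean document; each statement's English description precedes it below -/
import Mathlib

section
/- Let n be an even positive integer and let c be an element of ZMod n. If c = 2a for some a : ZMod n, then the permutation of ZMod n given by x ↦ c − x has exactly two fixed points and its cycle type is the multiset consisting of n/2 − 1 copies of 2. If c is not of the form 2a, then x ↦ c − x has no fixed points and its cycle type is the multiset consisting of n/2 copies of 2. -/
theorem reflection_aux (n : ℕ) [NeZero n] (c : ZMod n) : ∃ k : ℕ,
    Equiv.Perm.cycleType (Equiv.subLeft c : Equiv.Perm (ZMod n)) = Multiset.replicate k 2 ∧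
    (Finset.univ.filter fun x : ZMod n => (Equiv.subLeft c) x = x).card + k * 2 = n := by
  have h2 : (Equiv.subLeft c : Equiv.Perm (ZMod n)) ^ 2 = 1 := by
    ext x
    simp [pow_two]
  have h := Equiv.Perm.cycleType_of_pow_prime_eq_one h2
  refine ⟨_, h, ?_⟩
  have hs := Equiv.Perm.sum_cycleType (Equiv.subLeft c : Equiv.Perm (ZMod n))
  rw [h, Multiset.sum_replicate, smul_eq_mul] at hs
  rw [hs]
  have := Finset.card_filter_add_card_filter_not (s := (Finset.univ : Finset (ZMod n)))
    (fun x : ZMod n => (Equiv.subLeft c) x = x)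
  rw [Finset.card_univ, ZMod.card] at this
  exact this

theorem two_mul_zero_aux (m : ℕ) [NeZero (m + m)] (y : ZMod (m + m)) :
    2 * y = 0 ↔ y = 0 ∨ y = (m : ZMod (m + m)) := by
  constructor
  · intro h
    have hy := ZMod.natCast_zmod_val y
    have hlt := ZMod.val_lt y
    rw [← hy] at h
    have h' : ((2 * y.val : ℕ) : ZMod (m + m)) = 0 := by push_cast; exact h
    rw [ZMod.natCast_eq_zero_iff] at h'
    obtain ⟨k, hk⟩ := h'
    have hk2 : k < 2 := by
      by_contra hc
      have : (m + m) * 2 ≤ (m + m) * k := Nat.mul_le_mul_left _ (by omega)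
      omega
    interval_cases k
    · left; rw [← hy, show y.val = 0 by omega]; simp
    · right; rw [← hy, show y.val = m by omega]
  · rintro (rfl | rfl)
    · simp
    · have := ZMod.natCast_self (m + m)
      push_cast at this
      rw [two_mul]; exact this

theorem reflection_cycleType_even (n : ℕ) [NeZero n] (hn : Even n) (c : ZMod n) :
    ((∃ a : ZMod n, c = 2 * a) →
      (Finset.univ.filter fun x : ZMod n => (Equiv.subLeft c) x = x).card = 2 ∧
      Equiv.Perm.cycleType (Equiv.subLeft c : Equiv.Perm (ZMod n))
        = Multiset.replicate (n / 2 - 1) 2) ∧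
    ((¬ ∃ a : ZMod n, c = 2 * a) →
      (Finset.univ.filter fun x : ZMod n => (Equiv.subLeft c) x = x).card = 0 ∧
      Equiv.Perm.cycleType (Equiv.subLeft c : Equiv.Perm (ZMod n))
        = Multiset.replicate (n / 2) 2) := by
  obtain ⟨k, hk, hc⟩ := reflection_aux n c
  constructor
  · rintro ⟨a, ha⟩
    have hcard : (Finset.univ.filter fun x : ZMod n => (Equiv.subLeft c) x = x).card = 2 := by
      obtain ⟨m, rfl⟩ := hn
      have hm0 := NeZero.ne (m + m)
      have hm : (m : ZMod (m + m)) ≠ 0 := by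
        intro h
        rw [ZMod.natCast_eq_zero_iff] at h
        have := Nat.le_of_dvd (by omega) h
        omega
      rw [Finset.card_eq_two]
      refine ⟨a, a + m, by simpa using hm, ?_⟩
      ext x
      have := two_mul_zero_aux m (x - a)
      simp only [Finset.mem_filter, Finset.mem_univ, true_and, Finset.mem_insert,
        Finset.mem_singleton, Equiv.subLeft_apply]
      rw [sub_eq_zero, sub_eq_iff_eq_add'] at this
      rw [← this, ha]
      constructor
      · intro h; linear_combination -h
      · intro h; linear_combination -h
    refine ⟨hcard, ?_⟩
    rw [hk, show k = n / 2 - 1 by omega]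
  · intro hne
    have hcard : (Finset.univ.filter fun x : ZMod n => (Equiv.subLeft c) x = x).card = 0 := by
      rw [Finset.card_eq_zero, Finset.filter_eq_empty_iff]
      intro x _ hx
      rw [Equiv.subLeft_apply] at hx
      exact hne ⟨x, by linear_combination hx⟩
    refine ⟨hcard, ?_⟩
    rw [hk, show k = n / 2 by omega]
end

section
/- Let n ≥ 3 and k ≥ 0 be natural numbers, let G be the subgroup of Equiv.Perm (ZMod n) generated by the permutations x ↦ x + 1 and x ↦ −x, and let G act on the set of functions ZMod n → Fin k by (σ • f) = f ∘ σ⁻¹. Then 2n multiplied by the number of orbits of this action equals Σ_{d ∈ divisors(n)} φ(d) · k^{n/d} + R(n,k), where R(n,k) = n · k^{(n+1)/2} if n is odd, and R(n,k) = (n/2) · (k^{n/2 + 1} + k^{n/2}) if n is even. -/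
/-- The action of permutations of the vertices on colorings `ZMod n → Fin k`:
`σ • f = f ∘ σ⁻¹`. -/
instance permColoringAction (n k : ℕ) : MulAction (Equiv.Perm (ZMod n)) (ZMod n → Fin k) where
  smul σ f := f ∘ ⇑σ⁻¹
  one_smul f := by show f ∘ ⇑(1 : Equiv.Perm (ZMod n))⁻¹ = f; rw [inv_one]; rfl
  mul_smul σ τ f := by
    show f ∘ ⇑(σ * τ)⁻¹ = (f ∘ ⇑τ⁻¹) ∘ ⇑σ⁻¹
    rw [mul_inv_rev]; rfl

namespace Bracelet

lemma card_rot (n k : ℕ) [NeZero n] (c : ZMod n) :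
    Nat.card {f : ZMod n → Fin k // ∀ x, f (x + c) = f x} = k ^ (n / addOrderOf c) := by
  have key : ∀ f : ZMod n → Fin k, (∀ x, f (x + c) = f x) →
      ∀ (j : ℕ) x, f (x + j • c) = f x := by
    intro f hf j
    induction j with
    | zero => intro x; simp
    | succ j ih => intro x; rw [succ_nsmul, ← add_assoc, hf, ih]
  let e : {f : ZMod n → Fin k // ∀ x, f (x + c) = f x} ≃
      (ZMod n ⧸ AddSubgroup.zmultiples c → Fin k) :=
    { toFun := fun f q => Quotient.liftOn' q f.1 (by
        intro a b hab
        rw [QuotientAddGroup.leftRel_apply, ← mem_multiples_iff_mem_zmultiples] at hab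
        obtain ⟨j, hj⟩ := hab
        have := key f.1 f.2 j a
        have h2 : j • c = -a + b := hj
        rw [h2] at this
        simpa using this.symm)
      invFun := fun g => ⟨fun x => g (QuotientAddGroup.mk x), by
        intro x
        refine congrArg g ?_
        rw [QuotientAddGroup.eq]
        simp⟩
      left_inv := fun f => by ext x; rfl
      right_inv := fun g => by
        funext q
        induction q using QuotientAddGroup.induction_on with
        | H x => rfl }
  rw [Nat.card_congr e, Nat.card_fun]
  have h := AddSubgroup.card_eq_card_quotient_mul_card_addSubgroup (AddSubgroup.zmultiples c)
  rw [Nat.card_zmultiples, Nat.card_zmod] at h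
  rw [Nat.card_fin]
  congr 1
  exact (Nat.div_eq_of_eq_mul_left (addOrderOf_pos c) h).symm

lemma sum_rot (n k : ℕ) [NeZero n] :
    ∑ c : ZMod n, k ^ (n / addOrderOf c) = ∑ d ∈ n.divisors, Nat.totient d * k ^ (n / d) := by
  rw [← Finset.sum_fiberwise_of_maps_to (s := Finset.univ) (t := n.divisors)
    (g := fun c : ZMod n => addOrderOf c)]
  · refine Finset.sum_congr rfl fun d hd => ?_
    rw [Finset.sum_congr rfl (g := fun _ => k ^ (n / d))]
    · rw [Finset.sum_const, smul_eq_mul]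
      congr 1
      apply IsAddCyclic.card_addOrderOf_eq_totient
      rw [ZMod.card]
      exact Nat.dvd_of_mem_divisors hd
    · intro c hc
      rw [(Finset.mem_filter.1 hc).2]
  · intro c _
    rw [Nat.mem_divisors]
    refine ⟨?_, NeZero.ne n⟩
    have := addOrderOf_dvd_card (x := c)
    rwa [ZMod.card] at this

lemma card_invol {α : Type*} [Fintype α] [DecidableEq α] (k : ℕ) (r : α → ℕ)
    (hr : Function.Injective r)
    (s : α → α) (hs : ∀ x, s (s x) = x) :
    Nat.card {f : α → Fin k // ∀ x, f (s x) = f x} =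
      k ^ ((Fintype.card α + (Finset.univ.filter fun x => s x = x).card) / 2) := by
  let e : {f : α → Fin k // ∀ x, f (s x) = f x} ≃ ({x : α // r x ≤ r (s x)} → Fin k) :=
    { toFun := fun f x => f.1 x.1
      invFun := fun g => ⟨fun x => if h : r x ≤ r (s x) then g ⟨x, h⟩ else
          g ⟨s x, by rw [hs]; omega⟩, by
        intro x
        by_cases h1 : r x ≤ r (s x)
        · by_cases h2 : r (s x) ≤ r x
          · have : s x = x := hr (le_antisymm h2 h1)
            simp [this]
          · simp [hs, h1, h2]
        · have h2 : r (s x) ≤ r x := by omega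
          simp [hs, h1, h2]⟩
      left_inv := fun f => by
        ext x
        by_cases h1 : r x ≤ r (s x)
        · simp [h1]
        · simp [h1, f.2 x]
      right_inv := fun g => by
        funext x
        simp [x.2] }
  rw [Nat.card_congr e, Nat.card_fun, Nat.card_fin]
  congr 1
  rw [Nat.card_eq_fintype_card, Fintype.card_subtype]
  have h1 : (Finset.univ.filter fun x => r x ≤ r (s x)).card =
      (Finset.univ.filter fun x => r x < r (s x)).card +
      (Finset.univ.filter fun x => s x = x).card := by
    rw [← Finset.card_union_of_disjoint]
    · congr 1
      ext x
      simp only [Finset.mem_filter, Finset.mem_univ, true_and, Finset.mem_union]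
      rw [le_iff_lt_or_eq]
      exact or_congr Iff.rfl ⟨fun h => (hr h).symm, fun h => by rw [h]⟩
    · rw [Finset.disjoint_filter]
      intro x _ h h'
      rw [h'] at h
      omega
  have h2 : (Finset.univ.filter fun x => r x < r (s x)).card =
      (Finset.univ.filter fun x => ¬ r x ≤ r (s x)).card := by
    refine Finset.card_bij (fun x _ => s x) ?_ ?_ ?_
    · intro x hx
      simp [hs] at hx ⊢
      exact hx
    · intro x _ y _ h
      rw [← hs x, h, hs]
    · intro y hy
      refine ⟨s y, ?_, hs y⟩
      simp [hs] at hy ⊢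
      exact hy
  have h3 := Finset.card_filter_add_card_filter_not (s := (Finset.univ : Finset α))
    (fun x => r x ≤ r (s x))
  rw [Finset.card_univ] at h3
  omega

lemma sum_refl (n k : ℕ) [NeZero n] :
    ∑ c : ZMod n, k ^ ((n + (Finset.univ.filter fun x : ZMod n => c - x = x).card) / 2) =
     (if Odd n then n * k ^ ((n + 1) / 2) else (n / 2) * (k ^ (n / 2 + 1) + k ^ (n / 2))) := by
  have hF : ∀ c y : ZMod n, y + y = c → 
      (Finset.univ.filter fun x : ZMod n => c - x = x).card =
      (Finset.univ.filter fun x : ZMod n => x + x = 0).card := by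
    intro c y hy
    refine Finset.card_bij (fun x _ => x - y) ?_ ?_ ?_
    · intro x hx
      simp only [Finset.mem_filter, Finset.mem_univ, true_and] at hx ⊢
      linear_combination -hx - hy
    · intro a _ b _ h
      simpa using h
    · intro z hz
      simp only [Finset.mem_filter, Finset.mem_univ, true_and] at hz ⊢
      exact ⟨z + y, by linear_combination -hy - hz, by ring⟩
  have hz : ∀ z : ZMod n, z + z = 0 ↔ n ∣ 2 * z.val := by
    intro z
    rw [← ZMod.natCast_eq_zero_iff]
    push_cast
    rw [ZMod.natCast_zmod_val, two_mul]
  have hn : 0 < n := Nat.pos_of_ne_zero (NeZero.ne n)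
  have htot : ∑ c : ZMod n, (Finset.univ.filter fun x : ZMod n => c - x = x).card = n := by
    have := Finset.card_eq_sum_card_fiberwise (s := (Finset.univ : Finset (ZMod n)))
      (t := Finset.univ) (f := fun x => x + x) (by intro x _; simp)
    rw [Finset.card_univ, ZMod.card] at this
    refine Eq.trans ?_ this.symm
    refine Finset.sum_congr rfl fun c _ => ?_
    congr 1
    ext x
    simp only [Finset.mem_filter, Finset.mem_univ, true_and]
    exact ⟨fun h => by linear_combination -h, fun h => by linear_combination -h⟩
  have hex : ∀ c : ZMod n, (Finset.univ.filter fun x : ZMod n => c - x = x).card = 0 ∨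
      (Finset.univ.filter fun x : ZMod n => c - x = x).card =
      (Finset.univ.filter fun x : ZMod n => x + x = 0).card := by
    intro c
    by_cases h : ∃ y : ZMod n, y + y = c
    · obtain ⟨y, hy⟩ := h
      exact Or.inr (hF c y hy)
    · left
      rw [Finset.card_eq_zero, Finset.filter_eq_empty_iff]
      intro x _ hx
      exact h ⟨x, by linear_combination -hx⟩
  split_ifs with ho
  · have hK : (Finset.univ.filter fun x : ZMod n => x + x = 0).card = 1 := by
      rw [Finset.card_eq_one]
      refine ⟨0, ?_⟩
      ext z
      simp only [Finset.mem_filter, Finset.mem_univ, true_and, Finset.mem_singleton]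
      rw [hz, Nat.Coprime.dvd_mul_left (Nat.coprime_two_right.2 ho)]
      constructor
      · intro h
        rw [← ZMod.val_eq_zero]
        exact Nat.eq_zero_of_dvd_of_lt h (ZMod.val_lt z)
      · rintro rfl; simp
    rw [hK] at hex
    have : ∀ c ∈ (Finset.univ : Finset (ZMod n)),
        (Finset.univ.filter fun x : ZMod n => c - x = x).card = 1 := by
      rw [← Finset.sum_eq_sum_iff_of_le]
      · simp [htot, ZMod.card]
      · intro c _
        rcases hex c with h | h <;> omega
    rw [Finset.sum_congr rfl fun c hc => by rw [this c hc]]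
    simp [ZMod.card]
  · rw [Nat.not_odd_iff_even] at ho
    obtain ⟨m, hm⟩ := ho
    have hK : (Finset.univ.filter fun x : ZMod n => x + x = 0).card = 2 := by
      rw [Finset.card_eq_two]
      have hmv : ((m : ℕ) : ZMod n).val = m := ZMod.val_natCast_of_lt (by omega)
      refine ⟨0, (m : ZMod n), ?_, ?_⟩
      · intro h
        rw [← h, ZMod.val_zero] at hmv
        omega
      ext z
      simp only [Finset.mem_filter, Finset.mem_univ, true_and, Finset.mem_insert,
        Finset.mem_singleton]
      rw [hz]
      constructor
      · rintro ⟨q, hq⟩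
        have hlt := ZMod.val_lt z
        have hq2 : q < 2 := by
          by_contra hh
          have : n * 2 ≤ n * q := Nat.mul_le_mul_left _ (by omega)
          omega
        interval_cases q
        · left; rw [← ZMod.val_eq_zero]; omega
        · right
          apply ZMod.val_injective
          omega
      · rintro (rfl | rfl)
        · simp
        · rw [hmv]; exact ⟨1, by omega⟩
    rw [hK] at hex
    have hpow : ∀ c : ZMod n,
        2 * k ^ ((n + (Finset.univ.filter fun x : ZMod n => c - x = x).card) / 2) +
          (Finset.univ.filter fun x : ZMod n => c - x = x).card * k ^ m =
        2 * k ^ m + (Finset.univ.filter fun x : ZMod n => c - x = x).card * k ^ (m + 1) := by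
      intro c
      rcases hex c with h | h <;> rw [h]
      · rw [show (n + 0) / 2 = m by omega]; ring
      · rw [show (n + 2) / 2 = m + 1 by omega]; ring
    have hsum := Finset.sum_congr (rfl : (Finset.univ : Finset (ZMod n)) = _) fun c _ => hpow c
    rw [Finset.sum_add_distrib, Finset.sum_add_distrib, ← Finset.mul_sum, ← Finset.sum_mul,
      ← Finset.sum_mul, htot, Finset.sum_const, Finset.card_univ, ZMod.card, smul_eq_mul] at hsum
    rw [show n / 2 = m by omega]
    rw [← Finset.sum_mul, htot] at hsum
    generalize ∑ c : ZMod n,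
      k ^ ((n + (Finset.univ.filter fun x : ZMod n => c - x = x).card) / 2) = S at hsum ⊢
    rw [hm] at hsum
    linarith [hsum]

def elt (n : ℕ) : ZMod n ⊕ ZMod n → Equiv.Perm (ZMod n)
  | Sum.inl c => Equiv.addRight c
  | Sum.inr c => Equiv.subLeft c

lemma elt_injective (n : ℕ) (hn : 3 ≤ n) : Function.Injective (elt n) := by
  have h2 : (1 : ZMod n) + 1 ≠ 0 := by
    intro h
    have : ((2 : ℕ) : ZMod n) = 0 := by push_cast; rw [← h]; norm_num
    rw [ZMod.natCast_eq_zero_iff] at this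
    exact absurd (Nat.le_of_dvd (by norm_num) this) (by omega)
  rintro (a | a) (b | b) h
  all_goals
    have h0 := DFunLike.congr_fun h 0
    have h1 := DFunLike.congr_fun h 1
    simp [elt] at h0 h1
  · rw [h0]
  · exact absurd (by linear_combination h1 - h0) h2
  · exact absurd (by linear_combination h0 - h1) h2
  · rw [h0]

lemma mem_iff (n : ℕ) [NeZero n] (σ : Equiv.Perm (ZMod n)) :
    σ ∈ Subgroup.closure {(Equiv.addRight (1 : ZMod n) : Equiv.Perm (ZMod n)),
          (Equiv.neg (ZMod n) : Equiv.Perm (ZMod n))} ↔ ∃ c, elt n c = σ := by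
  constructor
  · intro h
    induction h using Subgroup.closure_induction with
    | mem x hx =>
      rcases hx with rfl | rfl
      · exact ⟨Sum.inl 1, rfl⟩
      · exact ⟨Sum.inr 0, by ext x; simp [elt]⟩
    | one => exact ⟨Sum.inl 0, by ext x; simp [elt]⟩
    | mul x y _ _ hx hy =>
      obtain ⟨a | a, rfl⟩ := hx <;> obtain ⟨b | b, rfl⟩ := hy
      · exact ⟨Sum.inl (a + b), by ext x; simp [elt]; ring⟩
      · exact ⟨Sum.inr (a + b), by ext x; simp [elt]; ring⟩
      · exact ⟨Sum.inr (a - b), by ext x; simp [elt]; ring⟩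
      · exact ⟨Sum.inl (a - b), by ext x; simp [elt]; ring⟩
    | inv x _ hx =>
      obtain ⟨a | a, rfl⟩ := hx
      · exact ⟨Sum.inl (-a), by rw [eq_inv_iff_mul_eq_one]; ext x; simp [elt]⟩
      · exact ⟨Sum.inr a, by rw [eq_inv_iff_mul_eq_one]; ext x; simp [elt]⟩
  · have hrot : ∀ c : ZMod n, Equiv.addRight c ∈
        Subgroup.closure {(Equiv.addRight (1 : ZMod n) : Equiv.Perm (ZMod n)),
          (Equiv.neg (ZMod n) : Equiv.Perm (ZMod n))} := by
      intro c
      have : ∀ j : ℕ, Equiv.addRight (j : ZMod n) ∈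
        Subgroup.closure {(Equiv.addRight (1 : ZMod n) : Equiv.Perm (ZMod n)),
          (Equiv.neg (ZMod n) : Equiv.Perm (ZMod n))} := by
        intro j
        induction j with
        | zero =>
          convert Subgroup.one_mem _
          ext x; simp
        | succ j ih =>
          convert Subgroup.mul_mem _ ih (Subgroup.subset_closure (Set.mem_insert _ _))
          ext x; simp; ring
      have h := this c.val
      rwa [ZMod.natCast_zmod_val] at h
    rintro ⟨c | c, rfl⟩
    · exact hrot c
    · convert Subgroup.mul_mem _ (hrot c) (Subgroup.subset_closure
        (Set.mem_insert_of_mem _ (Set.mem_singleton _)))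
      ext x; simp [elt]; ring

end Bracelet

open Bracelet in
theorem bracelet_count (n k : ℕ) (hn : 3 ≤ n) :
    (∀ (σ : Equiv.Perm (ZMod n)) (f : ZMod n → Fin k), σ • f = f ∘ ⇑σ⁻¹) ∧
    2 * n * Nat.card (Quotient (MulAction.orbitRel
        (Subgroup.closure {(Equiv.addRight (1 : ZMod n) : Equiv.Perm (ZMod n)),
          (Equiv.neg (ZMod n) : Equiv.Perm (ZMod n))}) (ZMod n → Fin k)))
      = ∑ d ∈ n.divisors, Nat.totient d * k ^ (n / d)
        + (if Odd n then n * k ^ ((n + 1) / 2) else (n / 2) * (k ^ (n / 2 + 1) + k ^ (n / 2))) := by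
  refine ⟨fun _ _ => rfl, ?_⟩
  have : NeZero n := ⟨by omega⟩
  classical
  let G := Subgroup.closure {(Equiv.addRight (1 : ZMod n) : Equiv.Perm (ZMod n)),
          (Equiv.neg (ZMod n) : Equiv.Perm (ZMod n))}
  let e : ZMod n ⊕ ZMod n ≃ G := Equiv.ofBijective
    (fun c => ⟨elt n c, (mem_iff n _).2 ⟨c, rfl⟩⟩)
    ⟨fun a b h => elt_injective n hn (Subtype.ext_iff.1 h),
      fun σ => by
        obtain ⟨c, hc⟩ := (mem_iff n σ.1).1 σ.2
        exact ⟨c, Subtype.ext hc⟩⟩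
  have hB := MulAction.sum_card_fixedBy_eq_card_orbits_mul_card_group G (ZMod n → Fin k)
  have hG : Fintype.card G = 2 * n := by
    rw [← Fintype.card_congr e, Fintype.card_sum, ZMod.card]; ring
  rw [hG, ← Nat.card_eq_fintype_card, mul_comm] at hB
  refine hB.symm.trans ?_
  rw [← e.sum_comp, Fintype.sum_sum_type]
  have hfix : ∀ (g : G) (f : ZMod n → Fin k),
      f ∈ MulAction.fixedBy (ZMod n → Fin k) g ↔ ∀ x, f (g.1 x) = f x := by
    intro g f
    rw [MulAction.mem_fixedBy]
    have : g • f = f ∘ ⇑(g.1)⁻¹ := rfl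
    rw [this]
    constructor
    · intro h x
      have := congr_fun h (g.1 x)
      simpa using this.symm
    · intro h
      funext x
      have := h (g.1⁻¹ x)
      simpa using this.symm
  congr 1
  · rw [← sum_rot]
    refine Finset.sum_congr rfl fun c _ => ?_
    rw [← card_rot, ← Nat.card_eq_fintype_card]
    exact Nat.card_congr (Equiv.subtypeEquivRight fun f => hfix _ f)
  · rw [← sum_refl]
    refine Finset.sum_congr rfl fun c _ => ?_
    have h := card_invol k ZMod.val (ZMod.val_injective n) (fun x : ZMod n => c - x)
      (fun x => by ring)
    rw [ZMod.card] at h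
    rw [← h, ← Nat.card_eq_fintype_card]
    exact Nat.card_congr (Equiv.subtypeEquivRight fun f => hfix _ f)
end

section
/- Let n ≥ 3 and let G be the subgroup of Equiv.Perm (ZMod n) generated by the permutations x ↦ x + 1 and x ↦ −x. In the polynomial ring MvPolynomial ℕ ℤ with variables X_1, X_2, X_3, …, one has Σ_{σ ∈ G} X_1^{n − s(σ)} · ∏_{d ∈ cycleType(σ)} X_d = Σ_{d ∈ divisors(n)} φ(d) · X_d^{n/d} + R(n), where s(σ) is the sum of the multiset cycleType(σ) (so n − s(σ) is the number of fixed points of σ), and R(n) = n · X_1 · X_2^{(n−1)/2} if n is odd, while R(n) = (n/2) · (X_1² · X_2^{n/2 − 1} + X_2^{n/2}) if n is even. -/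
open MvPolynomial

namespace DihedralAux

/-- The map enumerating rotations and reflections. -/
def enum (n : ℕ) : ZMod n ⊕ ZMod n → Equiv.Perm (ZMod n)
  | Sum.inl c => Equiv.addRight c
  | Sum.inr c => Equiv.subLeft c

theorem two_ne (n : ℕ) (hn : 3 ≤ n) : (1 : ZMod n) + 1 ≠ 0 := by
  intro h
  have h2 : ((2 : ℕ) : ZMod n) = 0 := by
    rw [← h]; push_cast; norm_num
  rw [ZMod.natCast_eq_zero_iff] at h2
  have := Nat.le_of_dvd (by norm_num) h2
  omega

theorem enum_injective (n : ℕ) (hn : 3 ≤ n) : Function.Injective (enum n) := by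
  have h2 := two_ne n hn
  rintro (a | a) (b | b) h
  · have := Equiv.congr_fun h 0
    simp [enum] at this
    rw [this]
  · have h0 := Equiv.congr_fun h 0
    have h1 := Equiv.congr_fun h 1
    simp [enum] at h0 h1
    exfalso; apply h2
    rw [h0] at h1
    linear_combination h1
  · have h0 := Equiv.congr_fun h 0
    have h1 := Equiv.congr_fun h 1
    simp [enum] at h0 h1
    exfalso; apply h2
    rw [h0] at h1
    linear_combination -h1
  · have := Equiv.congr_fun h 0
    simp [enum] at this
    rw [this]

theorem addRight_pow (n : ℕ) (c : ZMod n) (k : ℕ) (x : ZMod n) :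
    ((Equiv.addRight c : Equiv.Perm (ZMod n)) ^ k) x = x + k • c := by
  induction k with
  | zero => simp
  | succ k ih =>
    rw [pow_succ', Equiv.Perm.mul_apply, ih, succ_nsmul]
    simp [add_assoc]

theorem mem_closure_iff (n : ℕ) [NeZero n] (σ : Equiv.Perm (ZMod n)) :
    σ ∈ Subgroup.closure {(Equiv.addRight (1 : ZMod n) : Equiv.Perm (ZMod n)),
          (Equiv.neg (ZMod n) : Equiv.Perm (ZMod n))} ↔ ∃ y, enum n y = σ := by
  constructor
  · intro h
    induction h using Subgroup.closure_induction with
    | mem x hx =>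
      rcases hx with rfl | hx
      · exact ⟨Sum.inl 1, rfl⟩
      · rw [Set.mem_singleton_iff] at hx
        subst hx
        refine ⟨Sum.inr 0, ?_⟩
        ext x; simp [enum]
    | one => exact ⟨Sum.inl 0, by ext x; simp [enum]⟩
    | mul x y _ _ hx hy =>
      obtain ⟨a | a, rfl⟩ := hx <;> obtain ⟨b | b, rfl⟩ := hy
      · exact ⟨Sum.inl (a + b), by
          apply Equiv.ext; intro x; simp [enum]; ring⟩
      · exact ⟨Sum.inr (a + b), by
          apply Equiv.ext; intro x; simp [enum]; ring⟩
      · exact ⟨Sum.inr (a - b), by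
          apply Equiv.ext; intro x; simp [enum]; ring⟩
      · exact ⟨Sum.inl (a - b), by
          apply Equiv.ext; intro x; simp [enum]; ring⟩
    | inv x _ hx =>
      obtain ⟨a | a, rfl⟩ := hx
      · refine ⟨Sum.inl (-a), ?_⟩
        rw [eq_inv_iff_mul_eq_one]
        apply Equiv.ext; intro x; simp [enum]
      · refine ⟨Sum.inr a, ?_⟩
        rw [eq_inv_iff_mul_eq_one]
        apply Equiv.ext; intro x; simp [enum]
  · have hrot : ∀ c : ZMod n, (Equiv.addRight c : Equiv.Perm (ZMod n)) ∈
        Subgroup.closure {(Equiv.addRight (1 : ZMod n) : Equiv.Perm (ZMod n)),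
          (Equiv.neg (ZMod n) : Equiv.Perm (ZMod n))} := by
      intro c
      have : (Equiv.addRight c : Equiv.Perm (ZMod n)) =
          (Equiv.addRight (1 : ZMod n) : Equiv.Perm (ZMod n)) ^ c.val := by
        apply Equiv.ext; intro x
        rw [addRight_pow]
        simp
      rw [this]
      exact Subgroup.pow_mem _ (Subgroup.subset_closure (by simp)) _
    rintro ⟨c | c, rfl⟩
    · exact hrot c
    · have : enum n (Sum.inr c) = (Equiv.addRight c : Equiv.Perm (ZMod n)) *
          (Equiv.neg (ZMod n) : Equiv.Perm (ZMod n)) := by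
        apply Equiv.ext; intro x; simp [enum]; ring
      rw [this]
      exact Subgroup.mul_mem _ (hrot c) (Subgroup.subset_closure (by simp))

/-- The monomial attached to a permutation. -/
noncomputable def w (n : ℕ) [NeZero n] (σ : Equiv.Perm (ZMod n)) : MvPolynomial ℕ ℤ :=
  (X 1 : MvPolynomial ℕ ℤ) ^ (n - (Equiv.Perm.cycleType σ).sum) *
    ((Equiv.Perm.cycleType σ).map fun d => (X d : MvPolynomial ℕ ℤ)).prod

theorem orderOf_addRight (n : ℕ) (c : ZMod n) :
    orderOf (Equiv.addRight c : Equiv.Perm (ZMod n)) = addOrderOf c := by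
  apply Nat.dvd_antisymm
  · rw [orderOf_dvd_iff_pow_eq_one]
    apply Equiv.ext; intro x
    rw [addRight_pow, addOrderOf_nsmul_eq_zero]; simp
  · rw [addOrderOf_dvd_iff_nsmul_eq_zero]
    have := addRight_pow n c (orderOf (Equiv.addRight c : Equiv.Perm (ZMod n))) 0
    rw [pow_orderOf_eq_one] at this
    simpa using this.symm

theorem cycleType_addRight (n : ℕ) [NeZero n] (c : ZMod n) (m : ℕ)
    (hm : m ∈ (Equiv.addRight c : Equiv.Perm (ZMod n)).cycleType) : m = addOrderOf c := by
  apply Nat.dvd_antisymm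
  · rw [← orderOf_addRight]; exact Equiv.Perm.dvd_of_mem_cycleType hm
  · obtain ⟨ρ, τ, h, hd, hc, rfl⟩ := Equiv.Perm.mem_cycleType_iff.1 hm
    rw [addOrderOf_dvd_iff_nsmul_eq_zero]
    obtain ⟨x, hx, -⟩ := id hc
    have hτ : τ x = x := (hd x).resolve_left hx
    have h1 := addRight_pow n c ρ.support.card x
    rw [h, hd.commute.mul_pow, ← Equiv.Perm.IsCycle.orderOf hc, pow_orderOf_eq_one,
      one_mul, Equiv.Perm.pow_apply_eq_self_of_apply_eq_self hτ] at h1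
    rw [← Equiv.Perm.IsCycle.orderOf hc]
    simpa using h1.symm

theorem w_rot (n : ℕ) [NeZero n] (c : ZMod n) :
    w n (Equiv.addRight c) = X (addOrderOf c) ^ (n / addOrderOf c) := by
  by_cases hc : c = 0
  · subst hc
    have : (Equiv.addRight (0 : ZMod n) : Equiv.Perm (ZMod n)) = 1 := by
      apply Equiv.ext; intro x; simp
    simp [w, this]
  · have hrep := Multiset.eq_replicate_card.2 (cycleType_addRight n c)
    have hsum := Equiv.Perm.sum_cycleType (Equiv.addRight c : Equiv.Perm (ZMod n))
    have hsupp : (Equiv.addRight c : Equiv.Perm (ZMod n)).support = Finset.univ := by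
      ext x; simp [hc]
    rw [hsupp, Finset.card_univ, ZMod.card] at hsum
    have h0 : 0 < addOrderOf c := addOrderOf_pos c
    unfold w
    rw [hsum]
    rw [hrep] at hsum ⊢
    rw [Multiset.sum_replicate, smul_eq_mul] at hsum
    rw [Multiset.map_replicate, Multiset.prod_replicate, Nat.sub_self, pow_zero, one_mul,
      Nat.div_eq_of_eq_mul_left h0 hsum.symm]

theorem sum_rot (n : ℕ) [NeZero n] :
    ∑ c : ZMod n, w n (Equiv.addRight c) =
      ∑ d ∈ n.divisors, (Nat.totient d : MvPolynomial ℕ ℤ) * X d ^ (n / d) := by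
  have hmap : ∀ c ∈ (Finset.univ : Finset (ZMod n)), addOrderOf c ∈ n.divisors := by
    intro c _
    rw [Nat.mem_divisors]
    refine ⟨?_, NeZero.ne n⟩
    have := addOrderOf_dvd_card (x := c)
    rwa [ZMod.card] at this
  rw [← Finset.sum_fiberwise_of_maps_to hmap]
  refine Finset.sum_congr rfl fun d hd => ?_
  have hcard : (Finset.univ.filter fun c : ZMod n => addOrderOf c = d).card = d.totient := by
    apply IsAddCyclic.card_addOrderOf_eq_totient
    simpa using Nat.dvd_of_mem_divisors hd
  rw [← hcard, ← nsmul_eq_mul, ← Finset.sum_const]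
  refine Finset.sum_congr rfl fun c hc => ?_
  rw [w_rot, (Finset.mem_filter.1 hc).2]

/-- The number of fixed points of the reflection with parameter `c`. -/
def fx (n c : ℕ) : ℕ := ((Finset.range n).filter fun x => x + x = c ∨ x + x = c + n).card

theorem card_fix (n : ℕ) [NeZero n] (c : ZMod n) :
    (Finset.univ.filter fun x : ZMod n => c - x = x).card = fx n c.val := by
  unfold fx
  refine Finset.card_bij (fun x _ => x.val) ?_ ?_ ?_
  · intro x hx
    have hx : c - x = x := by simpa using hx
    have h1 : c = x + x := by linear_combination hx
    have hl := ZMod.val_lt x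
    simp only [Finset.mem_filter, Finset.mem_range]
    refine ⟨hl, ?_⟩
    rw [h1, ZMod.val_add]
    by_cases h : x.val + x.val < n
    · left; rw [Nat.mod_eq_of_lt h]
    · right; rw [Nat.mod_eq_sub_mod (by omega), Nat.mod_eq_of_lt (by omega)]; omega
  · intro a _ b _ h
    exact ZMod.val_injective n h
  · intro b hb
    simp only [Finset.mem_filter, Finset.mem_range] at hb
    refine ⟨(b : ZMod n), ?_, ZMod.val_cast_of_lt hb.1⟩
    simp only [Finset.mem_filter, Finset.mem_univ, true_and]
    have h1 : ((b + b : ℕ) : ZMod n) = c := by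
      rcases hb.2 with h | h <;> rw [h] <;> simp
    push_cast at h1
    linear_combination -h1

theorem fx_odd (n c : ℕ) (hn : Odd n) (hc : c < n) : fx n c = 1 := by
  obtain ⟨m, rfl⟩ := hn
  unfold fx
  rw [Finset.card_eq_one]
  rcases Nat.even_or_odd' c with ⟨k, rfl | rfl⟩
  · refine ⟨k, ?_⟩
    ext x; simp only [Finset.mem_filter, Finset.mem_range, Finset.mem_singleton]; omega
  · refine ⟨k + m + 1, ?_⟩
    ext x; simp only [Finset.mem_filter, Finset.mem_range, Finset.mem_singleton]; omega

theorem fx_even (m k : ℕ) (hc : k < m) : fx (2 * m) (2 * k) = 2 := by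
  unfold fx
  rw [Finset.card_eq_two]
  refine ⟨k, k + m, by omega, ?_⟩
  ext x
  simp only [Finset.mem_filter, Finset.mem_range, Finset.mem_singleton, Finset.mem_insert]; omega

theorem fx_even' (m k : ℕ) : fx (2 * m) (2 * k + 1) = 0 := by
  unfold fx
  rw [Finset.card_eq_zero]
  ext x
  simp only [Finset.mem_filter, Finset.mem_range, Finset.notMem_empty, iff_false]; omega

theorem w_refl (n : ℕ) [NeZero n] (c : ZMod n) :
    w n (Equiv.subLeft c) = X 1 ^ (fx n c.val) * X 2 ^ ((n - fx n c.val) / 2) := by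
  have hsq : (Equiv.subLeft c : Equiv.Perm (ZMod n)) ^ 2 = 1 := by
    apply Equiv.ext; intro x; simp [pow_two]
  have hrep := Equiv.Perm.cycleType_of_pow_prime_eq_one hsq
  have hsum := Equiv.Perm.sum_cycleType (Equiv.subLeft c : Equiv.Perm (ZMod n))
  have hsupp : (Equiv.Perm.support (Equiv.subLeft c : Equiv.Perm (ZMod n))).card + fx n c.val = n := by
    rw [← card_fix]
    have := Finset.card_filter_add_card_filter_not (s := (Finset.univ : Finset (ZMod n)))
      (fun x : ZMod n => c - x = x)
    rw [Finset.card_univ, ZMod.card] at this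
    have h2 : (Equiv.Perm.support (Equiv.subLeft c : Equiv.Perm (ZMod n))) =
        Finset.univ.filter fun x : ZMod n => ¬ (c - x = x) := by
      ext x; simp
    rw [h2]; omega
  unfold w
  rw [hsum]
  rw [hrep] at hsum ⊢
  rw [Multiset.sum_replicate, smul_eq_mul] at hsum
  rw [Multiset.map_replicate, Multiset.prod_replicate]
  congr 2 <;> omega

theorem sum_zmod_val (n : ℕ) [NeZero n] (f : ℕ → MvPolynomial ℕ ℤ) :
    ∑ c : ZMod n, f c.val = ∑ i ∈ Finset.range n, f i := by
  obtain ⟨m, rfl⟩ := Nat.exists_eq_succ_of_ne_zero (NeZero.ne n)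
  exact Fin.sum_univ_eq_sum_range f (m + 1)

theorem sum_range_two_mul (f : ℕ → MvPolynomial ℕ ℤ) (m : ℕ) :
    ∑ i ∈ Finset.range (2 * m), f i = ∑ i ∈ Finset.range m, (f (2 * i) + f (2 * i + 1)) := by
  induction m with
  | zero => simp
  | succ m ih =>
    rw [show 2 * (m + 1) = 2 * m + 1 + 1 by ring, Finset.sum_range_succ, Finset.sum_range_succ,
      Finset.sum_range_succ, ih]
    ring

theorem sum_refl (n : ℕ) [NeZero n] :
    ∑ c : ZMod n, w n (Equiv.subLeft c) =
      (if Odd n then (n : MvPolynomial ℕ ℤ) * X 1 * X 2 ^ ((n - 1) / 2)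
       else ((n / 2 : ℕ) : MvPolynomial ℕ ℤ) *
        (X 1 ^ 2 * X 2 ^ (n / 2 - 1) + X 2 ^ (n / 2))) := by
  rw [Finset.sum_congr rfl fun c _ => w_refl n c,
    sum_zmod_val n fun i => X 1 ^ (fx n i) * X 2 ^ ((n - fx n i) / 2)]
  split_ifs with h
  · rw [Finset.sum_congr rfl (g := fun _ => (X 1 : MvPolynomial ℕ ℤ) * X 2 ^ ((n - 1) / 2))]
    · simp [mul_assoc]
    · intro i hi
      rw [fx_odd n i h (Finset.mem_range.1 hi), pow_one]
  · rw [Nat.not_odd_iff_even, even_iff_exists_two_mul] at h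
    obtain ⟨m, hm⟩ := h
    rw [hm, sum_range_two_mul, Finset.sum_congr rfl
      (g := fun _ => (X 1 : MvPolynomial ℕ ℤ) ^ 2 * X 2 ^ (m - 1) + X 2 ^ m)]
    · simp [mul_add]
    · intro i hi
      rw [fx_even m i (Finset.mem_range.1 hi), fx_even']
      rw [show (2 * m - 2) / 2 = m - 1 by omega, show (2 * m - 0) / 2 = m by omega]
      simp

end DihedralAux

open scoped Classical in
theorem dihedral_cycle_index (n : ℕ) (hn : 3 ≤ n) :
    haveI : NeZero n := ⟨by omega⟩
    ∑ σ : (Subgroup.closure {(Equiv.addRight (1 : ZMod n) : Equiv.Perm (ZMod n)),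
          (Equiv.neg (ZMod n) : Equiv.Perm (ZMod n))} : Subgroup (Equiv.Perm (ZMod n))),
        (X 1 : MvPolynomial ℕ ℤ) ^ (n - (Equiv.Perm.cycleType (σ : Equiv.Perm (ZMod n))).sum) *
          ((Equiv.Perm.cycleType (σ : Equiv.Perm (ZMod n))).map fun d => (X d : MvPolynomial ℕ ℤ)).prod
      = ∑ d ∈ n.divisors, (Nat.totient d : MvPolynomial ℕ ℤ) * X d ^ (n / d)
        + (if Odd n then (n : MvPolynomial ℕ ℤ) * X 1 * X 2 ^ ((n - 1) / 2)
           else ((n / 2 : ℕ) : MvPolynomial ℕ ℤ) * (X 1 ^ 2 * X 2 ^ (n / 2 - 1) + X 2 ^ (n / 2))) := by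
  haveI : NeZero n := ⟨by omega⟩
  rw [← DihedralAux.sum_rot n, ← DihedralAux.sum_refl n]
  symm
  refine (Fintype.sum_sum_type (fun y => DihedralAux.w n (DihedralAux.enum n y))).symm.trans ?_
  refine Fintype.sum_bijective
    (fun y => ⟨DihedralAux.enum n y, (DihedralAux.mem_closure_iff n _).2 ⟨y, rfl⟩⟩) ⟨?_, ?_⟩ _ _ ?_
  · intro a b h
    exact DihedralAux.enum_injective n hn (congrArg Subtype.val h)
  · rintro ⟨σ, hσ⟩
    obtain ⟨y, rfl⟩ := (DihedralAux.mem_closure_iff n _).1 hσ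
    exact ⟨y, rfl⟩
  · intro y
    unfold DihedralAux.w
    congr!
end
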